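/- Assume the obstacle setting with obstacles K₁, …, K_h and cores C₁, …, C_h. Let s, t ∈ ℝ² with s, t ∉ interior Kᵢ for all i. Then for every continuous path γ : [0,1] → ℝ² with γ(0) = s and γ(1) = t whose image is disjoint from ⋃ᵢ interior Cᵢ, there exists a continuous path γ' : [0,1] → ℝ² with γ'(0) = s and γ'(1) = t whose image is disjoint from ⋃ᵢ interior Kᵢ and whose L1 length is at most the L1 length of γ. (Lemma 4 of the paper, path version: from any path avoiding the cores one obtains a path avoiding the obstacles that is no longer in the L1 metric.) -/

import Mathlib

open scoped ENNReal

noncomputable section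

/-- The plane with the `L1` metric. -/
abbrev Plane : Type := WithLp 1 (ℝ × ℝ)

/-- The `x`-coordinate of a point of the `L1` plane. -/
def px (p : Plane) : ℝ := (WithLp.equiv 1 (ℝ × ℝ) p).1

/-- The `y`-coordinate of a point of the `L1` plane. -/
def py (p : Plane) : ℝ := (WithLp.equiv 1 (ℝ × ℝ) p).2

open Set

/-! ### Pushing a path along a retraction -/

theorem eVariationOn_le_of_edist_le {α E F : Type*} [LinearOrder α] [PseudoEMetricSpace E]
    [PseudoEMetricSpace F] {f : α → E} {g : α → F} {s : Set α}
    (hfg : ∀ a ∈ s, ∀ b ∈ s, a ≤ b → edist (g a) (g b) ≤ eVariationOn f (s ∩ Icc a b)) :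
    eVariationOn g s ≤ eVariationOn f s := by
  refine iSup_le fun ⟨n, u, hu, hus⟩ => ?_
  calc ∑ i ∈ Finset.range n, edist (g (u (i + 1))) (g (u i))
      ≤ ∑ i ∈ Finset.range n, eVariationOn f (s ∩ Icc (u i) (u (i + 1))) := by
        refine Finset.sum_le_sum fun i _ => ?_
        rw [edist_comm]
        exact hfg _ (hus i) _ (hus (i + 1)) (hu i.le_succ)
    _ = eVariationOn f (s ∩ Icc (u 0) (u n)) := eVariationOn.sum f hu fun i _ _ => hus i
    _ ≤ eVariationOn f s := eVariationOn.mono f inter_subset_left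

section Retraction

variable {E : Type*} [PseudoMetricSpace E] {γ : ℝ → E} {T S O : Set E}

/-- A continuous path that joins a point of `S` to a point outside the closed set `T ⊇ S` meets
`T \ S`, provided that `S` is relatively open along the path. -/
theorem exists_mem_diff_of_continuousOn_Icc {a b : ℝ} (hab : a ≤ b)
    (hγ : ContinuousOn γ (Icc a b)) (hT : IsClosed T) (hO : IsOpen O)
    (hSO : ∀ c ∈ Icc a b, γ c ∈ S ↔ γ c ∈ O) (hST : S ⊆ T)
    (h : (γ a ∈ S ∧ γ b ∉ T) ∨ (γ a ∉ T ∧ γ b ∈ S)) :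
    ∃ c ∈ Icc a b, γ c ∈ T \ S := by
  by_contra! hcon
  have hpre : IsPreconnected (γ '' Icc a b) := isPreconnected_Icc.image _ hγ
  have hsub : γ '' Icc a b ⊆ O ∪ Tᶜ := by
    rintro _ ⟨c, hc, rfl⟩
    by_cases hcT : γ c ∈ T
    · left
      rw [← hSO c hc]
      by_contra hcS
      exact hcon c hc ⟨hcT, hcS⟩
    · exact Or.inr hcT
  have ha : a ∈ Icc a b := left_mem_Icc.2 hab
  have hb : b ∈ Icc a b := right_mem_Icc.2 hab
  obtain ⟨_, ⟨c, hc, rfl⟩, hcO, hcT⟩ := hpre O Tᶜ hO hT.isOpen_compl hsub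
    (by
      rcases h with h | h
      · exact ⟨_, mem_image_of_mem γ ha, (hSO a ha).1 h.1⟩
      · exact ⟨_, mem_image_of_mem γ hb, (hSO b hb).1 h.2⟩)
    (by
      rcases h with h | h
      · exact ⟨_, mem_image_of_mem γ hb, h.2⟩
      · exact ⟨_, mem_image_of_mem γ ha, h.1⟩)
  exact hcT (hST ((hSO c hc).2 hcO))

open Classical in
/-- Replacing the part of a path inside `S` by its image under a `1`-Lipschitz map `e` that fixes
`T \ S` keeps the path continuous and does not increase its length. -/
theorem continuousOn_and_eVariationOn_le_of_lipschitzOnWith {a₀ b₀ : ℝ} {e : E → E}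
    (hγ : ContinuousOn γ (Icc a₀ b₀)) (hT : IsClosed T) (hO : IsOpen O)
    (hSO : ∀ c ∈ Icc a₀ b₀, γ c ∈ S ↔ γ c ∈ O) (hST : S ⊆ T)
    (he : LipschitzOnWith 1 e T) (hfix : ∀ p ∈ T \ S, e p = p) :
    ContinuousOn (fun c => if γ c ∈ S then e (γ c) else γ c) (Icc a₀ b₀) ∧
      eVariationOn (fun c => if γ c ∈ S then e (γ c) else γ c) (Icc a₀ b₀) ≤
        eVariationOn γ (Icc a₀ b₀) := by
  set γ' : ℝ → E := fun c => if γ c ∈ S then e (γ c) else γ c with hγ'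
  have hγ'T : ∀ c, γ c ∈ T → γ' c = e (γ c) := by
    intro c hc
    by_cases hcS : γ c ∈ S
    · simp [hγ', hcS]
    · simp [hγ', hcS, hfix _ ⟨hc, hcS⟩]
  have hγ'S : ∀ c, γ c ∉ S → γ' c = γ c := fun c hc => by simp [hγ', hc]
  constructor
  · have hclosedT : IsClosed (Icc a₀ b₀ ∩ γ ⁻¹' T) :=
      hγ.preimage_isClosed_of_isClosed isClosed_Icc hT
    have hclosedO : IsClosed (Icc a₀ b₀ ∩ γ ⁻¹' Oᶜ) :=
      hγ.preimage_isClosed_of_isClosed isClosed_Icc hO.isClosed_compl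
    have h1 : ContinuousOn γ' (Icc a₀ b₀ ∩ γ ⁻¹' T) :=
      (he.continuousOn.comp (hγ.mono inter_subset_left) fun c hc => hc.2).congr
        fun c hc => hγ'T c hc.2
    have h2 : ContinuousOn γ' (Icc a₀ b₀ ∩ γ ⁻¹' Oᶜ) :=
      (hγ.mono inter_subset_left).congr fun c hc => hγ'S c fun h => hc.2 ((hSO c hc.1).1 h)
    refine (h1.union_of_isClosed h2 hclosedT hclosedO).mono fun c hc => ?_
    by_cases hcO : γ c ∈ O
    · exact Or.inl ⟨hc, hST ((hSO c hc).2 hcO)⟩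
    · exact Or.inr ⟨hc, hcO⟩
  · refine eVariationOn_le_of_edist_le fun a ha b hb hab => ?_
    have hsub : Icc a b ⊆ Icc a₀ b₀ := Icc_subset_Icc ha.1 hb.2
    rw [inter_eq_right.2 hsub]
    have haI : a ∈ Icc a b := left_mem_Icc.2 hab
    have hbI : b ∈ Icc a b := right_mem_Icc.2 hab
    have hboth : ∀ c d, γ c ∈ T → γ d ∈ T → edist (γ' c) (γ' d) ≤ edist (γ c) (γ d) := by
      intro c d hc hd
      rw [hγ'T c hc, hγ'T d hd]
      simpa using he hc hd
    have hnone : ∀ c d, γ c ∉ S → γ d ∉ S → edist (γ' c) (γ' d) ≤ edist (γ c) (γ d) := by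
      intro c d hc hd
      rw [hγ'S c hc, hγ'S d hd]
    have hmixed : (γ a ∈ S ∧ γ b ∉ T) ∨ (γ a ∉ T ∧ γ b ∈ S) →
        edist (γ' a) (γ' b) ≤ eVariationOn γ (Icc a b) := by
      intro h
      obtain ⟨c, hc, hcT, hcS⟩ := exists_mem_diff_of_continuousOn_Icc hab (hγ.mono hsub) hT hO
        (fun c hc => hSO c (hsub hc)) hST h
      calc edist (γ' a) (γ' b) ≤ edist (γ' a) (γ' c) + edist (γ' c) (γ' b) := edist_triangle _ _ _
        _ ≤ edist (γ a) (γ c) + edist (γ c) (γ b) := by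
          rcases h with ⟨h1, h2⟩ | ⟨h1, h2⟩
          · exact add_le_add (hboth _ _ (hST h1) hcT) (hnone _ _ hcS fun h => h2 (hST h))
          · exact add_le_add (hnone _ _ (fun h => h1 (hST h)) hcS) (hboth _ _ hcT (hST h2))
        _ ≤ eVariationOn γ (Icc a c) + eVariationOn γ (Icc c b) :=
          add_le_add
            (eVariationOn.edist_le γ (left_mem_Icc.2 hc.1) (right_mem_Icc.2 hc.1))
            (eVariationOn.edist_le γ (left_mem_Icc.2 hc.2) (right_mem_Icc.2 hc.2))
        _ = eVariationOn γ (Icc a b) := by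
          simpa using eVariationOn.Icc_add_Icc γ (s := univ) hc.1 hc.2 (mem_univ c)
    by_cases haT : γ a ∈ T <;> by_cases hbT : γ b ∈ T
    · exact (hboth _ _ haT hbT).trans (eVariationOn.edist_le γ haI hbI)
    · by_cases haS : γ a ∈ S
      · exact hmixed (Or.inl ⟨haS, hbT⟩)
      · exact (hnone _ _ haS fun h => hbT (hST h)).trans (eVariationOn.edist_le γ haI hbI)
    · by_cases hbS : γ b ∈ S
      · exact hmixed (Or.inr ⟨haT, hbS⟩)
      · exact (hnone _ _ (fun h => haT (hST h)) hbS).trans (eVariationOn.edist_le γ haI hbI)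
    · exact (hnone _ _ (fun h => haT (hST h)) fun h => hbT (hST h)).trans
        (eVariationOn.edist_le γ haI hbI)

end Retraction

/-! ### Reflected coordinates -/

/-- The `x`-coordinate, reflected when `σ = false`. -/
def signedX (σ : Bool) (p : Plane) : ℝ := cond σ (px p) (-px p)

/-- The `y`-coordinate, reflected when `τ = false`. -/
def signedY (τ : Bool) (p : Plane) : ℝ := cond τ (py p) (-py p)

theorem continuous_px : Continuous px := by
  unfold px
  simp only [WithLp.equiv_apply]
  fun_prop

theorem continuous_py : Continuous py := by
  unfold py
  simp only [WithLp.equiv_apply]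
  fun_prop

theorem continuous_signedX (σ : Bool) : Continuous (signedX σ) := by
  cases σ
  · exact continuous_px.neg
  · exact continuous_px

theorem continuous_signedY (τ : Bool) : Continuous (signedY τ) := by
  cases τ
  · exact continuous_py.neg
  · exact continuous_py

theorem signedX_add_smul (σ : Bool) (p v : Plane) (c : ℝ) :
    signedX σ (p + c • v) = signedX σ p + c * signedX σ v := by
  cases σ <;> simp [signedX, px]
  ring

theorem signedY_add_smul (τ : Bool) (p v : Plane) (c : ℝ) :
    signedY τ (p + c • v) = signedY τ p + c * signedY τ v := by
  cases τ <;> simp [signedY, py]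
  ring

theorem plane_ext {p q : Plane} (hx : px p = px q) (hy : py p = py q) : p = q :=
  (WithLp.equiv 1 (ℝ × ℝ)).injective (Prod.ext hx hy)

theorem plane_ext_signed {σ τ : Bool} {p q : Plane} (hx : signedX σ p = signedX σ q)
    (hy : signedY τ p = signedY τ q) : p = q := by
  apply plane_ext
  · cases σ <;> simpa [signedX] using hx
  · cases τ <;> simpa [signedY] using hy

theorem exists_signed_eq (σ τ : Bool) (x y : ℝ) :
    ∃ v : Plane, signedX σ v = x ∧ signedY τ v = y := by
  refine ⟨WithLp.toLp 1 (cond σ x (-x), cond τ y (-y)), ?_, ?_⟩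
  · cases σ <;> simp [signedX, px]
  · cases τ <;> simp [signedY, py]

theorem dist_eq_signed (σ τ : Bool) (p q : Plane) :
    dist p q = |signedX σ p - signedX σ q| + |signedY τ p - signedY τ q| := by
  have h : dist p q = |px p - px q| + |py p - py q| := by
    simp [WithLp.prod_dist_eq_of_L1, Real.dist_eq, px, py]
  rw [h]
  congr 1
  · cases σ
    · rw [abs_sub_comm]
      congr 1
      simp only [signedX, cond_false]
      ring
    · rfl
  · cases τ
    · rw [abs_sub_comm]
      congr 1
      simp only [signedY, cond_false]
      ring
    · rfl

theorem exists_strongDual_eq (σ τ : Bool) (f : StrongDual ℝ Plane) :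
    ∃ α β : ℝ, ∀ p, f p = α * signedX σ p + β * signedY τ p := by
  obtain ⟨v, hvx, hvy⟩ := exists_signed_eq σ τ 1 0
  obtain ⟨w, hwx, hwy⟩ := exists_signed_eq σ τ 0 1
  refine ⟨f v, f w, fun p => ?_⟩
  have hp : p = (0 + signedX σ p • v) + signedY τ p • w := by
    have h0x : signedX σ 0 = 0 := by cases σ <;> simp [signedX, px]
    have h0y : signedY τ 0 = 0 := by cases τ <;> simp [signedY, py]
    apply plane_ext_signed (σ := σ) (τ := τ) <;>
      simp only [signedX_add_smul, signedY_add_smul, hvx, hvy, hwx, hwy, h0x, h0y] <;> ring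
  conv_lhs => rw [hp]
  simp [mul_comm]

theorem exists_pos_add_smul_mem {K : Set Plane} {p : Plane} (hp : p ∈ interior K) (v : Plane) :
    ∃ c : ℝ, 0 < c ∧ p + c • v ∈ K := by
  have hcont : Continuous fun c : ℝ => p + c • v := by fun_prop
  have hmem : (fun c : ℝ => p + c • v) ⁻¹' K ∈ nhds 0 :=
    hcont.continuousAt.preimage_mem_nhds (by simpa using mem_interior_iff_mem_nhds.1 hp)
  obtain ⟨ε, hε, hball⟩ := Metric.mem_nhds_iff.1 hmem
  refine ⟨ε / 2, half_pos hε, hball (a := ε / 2) ?_⟩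
  simp [abs_of_pos hε, hε]

theorem signedX_lt_of_mem_interior {K : Set Plane} {p : Plane} (hp : p ∈ interior K) {σ : Bool}
    {M : ℝ} (hM : ∀ q ∈ K, signedX σ q ≤ M) : signedX σ p < M := by
  obtain ⟨v, hv, -⟩ := exists_signed_eq σ true 1 0
  obtain ⟨c, hc, hmem⟩ := exists_pos_add_smul_mem hp v
  have := hM _ hmem
  rw [signedX_add_smul, hv] at this
  linarith

theorem lt_signedX_of_mem_interior {K : Set Plane} {p : Plane} (hp : p ∈ interior K) {σ : Bool}
    {M : ℝ} (hM : ∀ q ∈ K, M ≤ signedX σ q) : M < signedX σ p := by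
  obtain ⟨v, hv, -⟩ := exists_signed_eq σ true (-1) 0
  obtain ⟨c, hc, hmem⟩ := exists_pos_add_smul_mem hp v
  have := hM _ hmem
  rw [signedX_add_smul, hv] at this
  linarith

theorem signedY_lt_of_mem_interior {K : Set Plane} {p : Plane} (hp : p ∈ interior K) {τ : Bool}
    {M : ℝ} (hM : ∀ q ∈ K, signedY τ q ≤ M) : signedY τ p < M := by
  obtain ⟨v, -, hv⟩ := exists_signed_eq true τ 0 1
  obtain ⟨c, hc, hmem⟩ := exists_pos_add_smul_mem hp v
  have := hM _ hmem
  rw [signedY_add_smul, hv] at this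
  linarith

/-! ### The corner of a convex set cut off by a chord -/

/-- `chordSide σ τ a b p` is nonnegative when `p` lies weakly above the line through `a` and `b`,
in the coordinates `signedX σ` and `signedY τ`. -/
def chordSide (σ τ : Bool) (a b p : Plane) : ℝ :=
  (signedX σ b - signedX σ a) * (signedY τ p - signedY τ a) -
    (signedY τ b - signedY τ a) * (signedX σ p - signedX σ a)

theorem continuous_chordSide (σ τ : Bool) (a b : Plane) : Continuous (chordSide σ τ a b) := by
  have := continuous_signedX σ
  have := continuous_signedY τ
  unfold chordSide
  fun_prop

/-- In the coordinates `signedX σ` and `signedY τ`, the points `a`, `b` and `d` of `K` are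
leftmost, topmost and rightmost, respectively. -/
structure IsChordCorner (K : Set Plane) (σ τ : Bool) (a b d : Plane) : Prop where
  left_mem : a ∈ K
  top_mem : b ∈ K
  right_mem : d ∈ K
  left_le : ∀ q ∈ K, signedX σ a ≤ signedX σ q
  le_top : ∀ q ∈ K, signedY τ q ≤ signedY τ b
  le_right : ∀ q ∈ K, signedX σ q ≤ signedX σ d
  left_ne_top : a ≠ b
  right_ne_top : d ≠ b

namespace IsChordCorner

variable {K : Set Plane} {σ τ : Bool} {a b d p q : Plane}

theorem lt_top_and_left_lt (hc : IsChordCorner K σ τ a b d) (hx : signedX σ a < signedX σ p)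
    (hy : signedY τ p < signedY τ b) (hp : 0 ≤ chordSide σ τ a b p) :
    signedX σ p < signedX σ b ∧ signedY τ a < signedY τ p := by
  have h1 := hc.left_le b hc.top_mem
  have h2 := hc.le_top a hc.left_mem
  unfold chordSide at hp
  constructor
  · by_contra! h
    rcases h1.eq_or_lt with h1 | h1
    · rcases h2.eq_or_lt with h2 | h2
      · exact hc.left_ne_top (plane_ext_signed h1 h2)
      · nlinarith [mul_pos (sub_pos.2 h2) (sub_pos.2 hx)]
    · nlinarith [mul_pos (sub_pos.2 h1) (sub_pos.2 hy),
        mul_nonneg (sub_nonneg.2 h2) (sub_nonneg.2 h)]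
  · by_contra! h
    rcases h2.eq_or_lt with h2 | h2
    · rcases h1.eq_or_lt with h1 | h1
      · exact hc.left_ne_top (plane_ext_signed h1 h2)
      · nlinarith [mul_pos (sub_pos.2 h1) (sub_pos.2 hy)]
    · nlinarith [mul_pos (sub_pos.2 h2) (sub_pos.2 hx),
        mul_nonneg (sub_nonneg.2 h1) (sub_nonneg.2 h)]

/-- A point of the corner with a point of `K` strictly to its left and above it is interior. -/
theorem mem_interior_of_lt (hc : IsChordCorner K σ τ a b d) (hK : Convex ℝ K)
    (hint : (interior K).Nonempty) (hp : 0 ≤ chordSide σ τ a b p)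
    (hq : q ∈ K) (hx : signedX σ q < signedX σ p) (hy : signedY τ p < signedY τ q) :
    p ∈ interior K := by
  by_contra hpint
  obtain ⟨f, hf0, hf⟩ := geometric_hahn_banach_of_nonempty_interior_point hK hpint hint
  obtain ⟨α, β, hαβ⟩ := exists_strongDual_eq σ τ f
  have hax : signedX σ a < signedX σ p := (hc.left_le q hq).trans_lt hx
  have hby : signedY τ p < signedY τ b := hy.trans_le (hc.le_top q hq)
  obtain ⟨hbx, hay⟩ := hc.lt_top_and_left_lt hax hby hp
  have hfq := hf q hq
  have hfa := hf a hc.left_mem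
  have hfb := hf b hc.top_mem
  have hfd := hf d hc.right_mem
  have hdx := hc.le_right b hc.top_mem
  have hdy := hc.le_top d hc.right_mem
  simp only [hαβ] at hfq hfa hfb hfd
  have hd : ¬(signedX σ d = signedX σ b ∧ signedY τ d = signedY τ b) :=
    fun h => hc.right_ne_top (plane_ext_signed h.1 h.2)
  have hne : ¬(α = 0 ∧ β = 0) := by
    rintro ⟨rfl, rfl⟩
    exact hf0 (ContinuousLinearMap.ext fun p => by simp [hαβ])
  unfold chordSide at hp
  generalize signedX σ p = X at *
  generalize signedY τ p = Y at *
  obtain ⟨a1, ha1⟩ : ∃ a1, a1 = X - signedX σ a := ⟨_, rfl⟩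
  obtain ⟨a2, ha2⟩ : ∃ a2, a2 = Y - signedY τ a := ⟨_, rfl⟩
  obtain ⟨b1, hb1⟩ : ∃ b1, b1 = signedX σ b - X := ⟨_, rfl⟩
  obtain ⟨b2, hb2⟩ : ∃ b2, b2 = signedY τ b - Y := ⟨_, rfl⟩
  obtain ⟨d1, hd1⟩ : ∃ d1, d1 = signedX σ d - X := ⟨_, rfl⟩
  obtain ⟨d2, hd2⟩ : ∃ d2, d2 = signedY τ d - Y := ⟨_, rfl⟩
  obtain ⟨q1, hq1⟩ : ∃ q1, q1 = X - signedX σ q := ⟨_, rfl⟩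
  obtain ⟨q2, hq2⟩ : ∃ q2, q2 = signedY τ q - Y := ⟨_, rfl⟩
  have pa1 : 0 < a1 := by linarith
  have pa2 : 0 < a2 := by linarith
  have pb1 : 0 < b1 := by linarith
  have pb2 : 0 < b2 := by linarith
  have pq1 : 0 < q1 := by linarith
  have pq2 : 0 < q2 := by linarith
  have hdb1 : b1 ≤ d1 := by linarith
  have hdb2 : d2 ≤ b2 := by linarith
  have hside : b2 * a1 ≤ b1 * a2 := by
    rw [ha1, ha2, hb1, hb2]; linarith
  have fa : 0 ≤ α * a1 + β * a2 := by rw [ha1, ha2]; linarith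
  have fb : α * b1 + β * b2 ≤ 0 := by rw [hb1, hb2]; linarith
  have fd : α * d1 + β * d2 ≤ 0 := by rw [hd1, hd2]; linarith
  have fq : β * q2 ≤ α * q1 := by rw [hq1, hq2]; linarith
  have hd' : ¬(d1 = b1 ∧ d2 = b2) := fun h => hd ⟨by linarith [h.1], by linarith [h.2]⟩
  clear ha1 ha2 hb1 hb2 hd1 hd2 hq1 hq2 hd hp hfq hfa hfb hfd hdx hdy hax hby hbx hay hx hy
  rcases lt_trichotomy β 0 with hβ | hβ | hβ
  · have hα : 0 < α := by
      by_contra! h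
      nlinarith [mul_nonneg (neg_nonneg.2 h) pa1.le, mul_pos (neg_pos.2 hβ) pa2]
    have h1 : α * d1 ≤ -β * b2 := by
      nlinarith [mul_nonneg (neg_nonneg.2 hβ.le) (sub_nonneg.2 hdb2)]
    have h2 : -β * b2 ≤ α * b1 := by
      have h3 : (-β * b2) * a1 ≤ (α * b1) * a1 := by
        nlinarith [mul_le_mul_of_nonneg_left hside (neg_nonneg.2 hβ.le),
          mul_le_mul_of_nonneg_left fa pb1.le]
      exact le_of_mul_le_mul_right h3 pa1
    have h4 : d1 = b1 := le_antisymm (le_of_mul_le_mul_left (h1.trans h2) hα) hdb1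
    refine hd' ⟨h4, le_antisymm hdb2 ?_⟩
    subst h4
    have h5 : -β * b2 ≤ -β * d2 := by linarith
    exact le_of_mul_le_mul_left h5 (neg_pos.2 hβ)
  · subst hβ
    refine hne ⟨le_antisymm ?_ ?_, rfl⟩
    · by_contra! h
      nlinarith [mul_pos h pb1]
    · by_contra! h
      nlinarith [mul_pos (neg_pos.2 h) pa1]
  · have hα : 0 < α := by
      by_contra! h
      nlinarith [mul_nonneg (neg_nonneg.2 h) pq1.le, mul_pos hβ pq2]
    nlinarith [mul_pos hα pb1, mul_pos hβ pb2]

/-- Every point of the corner can be moved along an antidiagonal to a boundary point of `K` that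
still lies in the corner. -/
theorem exists_exit (hc : IsChordCorner K σ τ a b d) (hKc : IsCompact K) (hp : p ∈ K)
    (hside : 0 ≤ chordSide σ τ a b p) :
    ∃ z ∈ K, z ∉ interior K ∧ 0 ≤ chordSide σ τ a b z ∧
      signedX σ z + signedY τ z = signedX σ p + signedY τ p := by
  have hcompact : IsCompact (K ∩ {z | 0 ≤ chordSide σ τ a b z ∧
      signedX σ z + signedY τ z = signedX σ p + signedY τ p}) :=
    hKc.inter_right ((isClosed_le continuous_const (continuous_chordSide σ τ a b)).inter
      (isClosed_eq ((continuous_signedX σ).add (continuous_signedY τ)) continuous_const))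
  obtain ⟨z, ⟨hzK, hzside, hz⟩, hmax⟩ := hcompact.exists_isMaxOn ⟨p, hp, hside, rfl⟩
    (continuous_signedY τ).continuousOn
  refine ⟨z, hzK, fun hzint => ?_, hzside, hz⟩
  obtain ⟨v, hvx, hvy⟩ := exists_signed_eq σ τ (-1) 1
  obtain ⟨c, hcpos, hmem⟩ := exists_pos_add_smul_mem hzint v
  have hle : signedY τ (z + c • v) ≤ signedY τ z := hmax ⟨hmem, by
    have h1 := hc.left_le b hc.top_mem
    have h2 := hc.le_top a hc.left_mem
    unfold chordSide at hzside ⊢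
    rw [signedX_add_smul, signedY_add_smul, hvx, hvy]
    nlinarith [mul_nonneg hcpos.le (sub_nonneg.2 h1), mul_nonneg hcpos.le (sub_nonneg.2 h2)], by
    rw [signedX_add_smul, signedY_add_smul, hvx, hvy]
    linarith⟩
  rw [signedY_add_smul, hvy] at hle
  linarith

/-- The corner retracts onto its outer boundary by a map that is `1`-Lipschitz for the `L1`
metric. -/
theorem exists_retraction (hc : IsChordCorner K σ τ a b d) (hKc : IsCompact K) (hK : Convex ℝ K)
    (hint : (interior K).Nonempty) :
    ∃ e : Plane → Plane, LipschitzOnWith 1 e (K ∩ {p | 0 ≤ chordSide σ τ a b p}) ∧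
      (∀ p ∈ K ∩ {p | 0 ≤ chordSide σ τ a b p}, e p ∈ K \ interior K) ∧
      ∀ p ∈ K ∩ {p | 0 ≤ chordSide σ τ a b p}, p ∉ interior K → e p = p := by
  choose! e heK heint heside hesum using fun p (hp : p ∈ K ∩ {p | 0 ≤ chordSide σ τ a b p}) =>
    hc.exists_exit hKc hp.1 hp.2
  have hmono : ∀ z w, z ∈ K → w ∈ K → z ∉ interior K → w ∉ interior K →
      0 ≤ chordSide σ τ a b z → 0 ≤ chordSide σ τ a b w →
      signedX σ z + signedY τ z ≤ signedX σ w + signedY τ w →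
      signedX σ z ≤ signedX σ w ∧ signedY τ z ≤ signedY τ w := by
    intro z w hz hw hzi hwi hzs hws hle
    constructor
    · by_contra! h
      exact hzi (hc.mem_interior_of_lt hK hint hzs hw h (by linarith))
    · by_contra! h
      exact hwi (hc.mem_interior_of_lt hK hint hws hz (by linarith) h)
  refine ⟨e, LipschitzOnWith.of_dist_le_mul fun p hp q hq => ?_,
    fun p hp => ⟨heK p hp, heint p hp⟩, fun p hp hpi => ?_⟩
  · have hp' := hesum p hp
    have hq' := hesum q hq
    rw [NNReal.coe_one, one_mul, dist_eq_signed σ τ, dist_eq_signed σ τ p q]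
    have h1 := abs_add_le (signedX σ p - signedX σ q) (signedY τ p - signedY τ q)
    rcases le_total (signedX σ (e p) + signedY τ (e p)) (signedX σ (e q) + signedY τ (e q))
      with h | h
    · obtain ⟨hx, hy⟩ := hmono _ _ (heK p hp) (heK q hq) (heint p hp) (heint q hq)
        (heside p hp) (heside q hq) h
      rw [abs_of_nonpos (sub_nonpos.2 hx), abs_of_nonpos (sub_nonpos.2 hy)]
      rw [abs_of_nonpos (by linarith)] at h1
      linarith
    · obtain ⟨hx, hy⟩ := hmono _ _ (heK q hq) (heK p hp) (heint q hq) (heint p hp)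
        (heside q hq) (heside p hp) h
      rw [abs_of_nonneg (sub_nonneg.2 hx), abs_of_nonneg (sub_nonneg.2 hy)]
      rw [abs_of_nonneg (by linarith)] at h1
      linarith
  · obtain ⟨hx, hy⟩ := hmono _ _ (heK p hp) hp.1 (heint p hp) hpi (heside p hp) hp.2
      (hesum p hp).le
    obtain ⟨hx', hy'⟩ := hmono _ _ hp.1 (heK p hp) hpi (heint p hp) hp.2 (heside p hp)
      (hesum p hp).ge
    exact plane_ext_signed (le_antisymm hx hx') (le_antisymm hy hy')

/-- If a linear functional pointing to the upper left separates `p` from the chord, then `p` lies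
above the chord. -/
theorem chordSide_nonneg_of_separated (hc : IsChordCorner K σ τ a b d) (hp : p ∈ K) {α β : ℝ}
    (hα : α ≤ 0) (hβ : 0 ≤ β)
    (ha : α * signedX σ a + β * signedY τ a < α * signedX σ p + β * signedY τ p)
    (hb : α * signedX σ b + β * signedY τ b < α * signedX σ p + β * signedY τ p) :
    0 ≤ chordSide σ τ a b p := by
  have h1 : 0 ≤ signedX σ p - signedX σ a := sub_nonneg.2 (hc.left_le p hp)
  have h2 : 0 ≤ signedY τ b - signedY τ p := sub_nonneg.2 (hc.le_top p hp)
  unfold chordSide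
  obtain ⟨u, hu⟩ : ∃ u, u = signedX σ p - signedX σ a := ⟨_, rfl⟩
  obtain ⟨v, hv⟩ : ∃ v, v = signedY τ p - signedY τ a := ⟨_, rfl⟩
  obtain ⟨w, hw⟩ : ∃ w, w = signedX σ b - signedX σ p := ⟨_, rfl⟩
  obtain ⟨z, hz⟩ : ∃ z, z = signedY τ b - signedY τ p := ⟨_, rfl⟩
  rw [← hu] at h1
  rw [← hz] at h2
  have ha' : -α * u < β * v := by rw [hu, hv]; linarith
  have hb' : β * z < -α * w := by rw [hw, hz]; linarith
  have hβ' : 0 < β := by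
    rcases hβ.eq_or_lt with rfl | h
    · nlinarith [mul_nonneg (neg_nonneg.2 hα) h1]
    · exact h
  have hw' : 0 < w := by
    by_contra! h
    nlinarith [mul_nonneg hβ h2, mul_nonneg (neg_nonneg.2 hα) (neg_nonneg.2 h)]
  have key : z * u ≤ w * v := by
    have : β * (z * u) ≤ β * (w * v) := by
      nlinarith [mul_le_mul_of_nonneg_right hb'.le h1, mul_le_mul_of_nonneg_left ha'.le hw'.le]
    exact le_of_mul_le_mul_left this hβ'
  have e1 : signedX σ b - signedX σ a = w + u := by rw [hw, hu]; ring
  have e2 : signedY τ b - signedY τ a = z + v := by rw [hz, hv]; ring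
  rw [e1, e2, ← hu, ← hv]
  linarith

end IsChordCorner

/-! ### Obstacles, cores and pockets -/

/-- `K` is a compact convex set, and `l`, `r`, `t`, `m` are distinct leftmost, rightmost, topmost
and bottommost points of it. -/
structure IsObstacle (K : Set Plane) (l r t m : Plane) : Prop where
  isCompact : IsCompact K
  convex : Convex ℝ K
  l_mem : l ∈ K
  r_mem : r ∈ K
  t_mem : t ∈ K
  m_mem : m ∈ K
  l_le : ∀ q ∈ K, px l ≤ px q
  le_r : ∀ q ∈ K, px q ≤ px r
  le_t : ∀ q ∈ K, py q ≤ py t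
  m_le : ∀ q ∈ K, py m ≤ py q
  ne : l ≠ r ∧ l ≠ t ∧ l ≠ m ∧ r ≠ t ∧ r ≠ m ∧ t ≠ m

/-- The side of the line through the `c`-th chord of the core that is opposite to the core, where
`c.1` chooses between left and right, and `c.2` between top and bottom. -/
def outerSide (l r t m : Plane) (c : Bool × Bool) : Set Plane :=
  {p | 0 ≤ chordSide c.1 c.2 (cond c.1 l r) (cond c.2 t m) p}

theorem isClosed_outerSide (l r t m : Plane) (c : Bool × Bool) :
    IsClosed (outerSide l r t m c) :=
  isClosed_le continuous_const (continuous_chordSide _ _ _ _)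

theorem IsChordCorner.chordSide_neg_of_opposite {K : Set Plane} {σ τ : Bool} {a b d e p : Plane}
    (hc : IsChordCorner K σ τ a b d) (hc' : IsChordCorner K (!σ) (!τ) d e a) (hae : a ≠ e)
    (hp : p ∈ interior K) (h : 0 ≤ chordSide σ τ a b p) : chordSide (!σ) (!τ) d e p < 0 := by
  by_contra! h'
  obtain ⟨h1, h2⟩ := hc.lt_top_and_left_lt (lt_signedX_of_mem_interior hp hc.left_le)
    (signedY_lt_of_mem_interior hp hc.le_top) h
  obtain ⟨h3, h4⟩ := hc'.lt_top_and_left_lt (lt_signedX_of_mem_interior hp hc'.left_le)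
    (signedY_lt_of_mem_interior hp hc'.le_top) h'
  have hax := hc.left_le e hc'.top_mem
  have hdx := hc.le_right b hc.top_mem
  have hdy := hc.le_top d hc.right_mem
  have hey := hc'.le_top a hc.left_mem
  have hX : ∀ q, signedX (!σ) q = -signedX σ q := fun q => by cases σ <;> simp [signedX]
  have hY : ∀ q, signedY (!τ) q = -signedY τ q := fun q => by cases τ <;> simp [signedY]
  have hne : ¬(signedX σ a = signedX σ e ∧ signedY τ a = signedY τ e) :=
    fun h => hae (plane_ext_signed h.1 h.2)
  unfold chordSide at h h'
  simp only [hX, hY] at h' h3 h4 hey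
  obtain ⟨a1, ha1⟩ : ∃ x, x = signedX σ p - signedX σ a := ⟨_, rfl⟩
  obtain ⟨a2, ha2⟩ : ∃ x, x = signedY τ p - signedY τ a := ⟨_, rfl⟩
  obtain ⟨b1, hb1⟩ : ∃ x, x = signedX σ b - signedX σ p := ⟨_, rfl⟩
  obtain ⟨b2, hb2⟩ : ∃ x, x = signedY τ b - signedY τ p := ⟨_, rfl⟩
  obtain ⟨e1, he1⟩ : ∃ x, x = signedX σ p - signedX σ e := ⟨_, rfl⟩
  obtain ⟨e2, he2⟩ : ∃ x, x = signedY τ p - signedY τ e := ⟨_, rfl⟩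
  obtain ⟨d1, hd1⟩ : ∃ x, x = signedX σ d - signedX σ p := ⟨_, rfl⟩
  obtain ⟨d2, hd2⟩ : ∃ x, x = signedY τ d - signedY τ p := ⟨_, rfl⟩
  have pb1 : 0 < b1 := by linarith
  have pa2 : 0 < a2 := by linarith
  have pe1 : 0 < e1 := by linarith
  have pd2 : 0 < d2 := by linarith
  have hea : e1 ≤ a1 := by linarith
  have hae : a2 ≤ e2 := by linarith
  have hbd : b1 ≤ d1 := by linarith
  have hdb : d2 ≤ b2 := by linarith
  have s1 : a1 * b2 ≤ b1 * a2 := by rw [ha1, ha2, hb1, hb2]; linarith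
  have s2 : e2 * d1 ≤ e1 * d2 := by rw [he1, he2, hd1, hd2]; linarith
  have s3 : e1 * d2 ≤ a1 * d2 := mul_le_mul_of_nonneg_right hea pd2.le
  have s4 : a1 * d2 ≤ a1 * b2 := mul_le_mul_of_nonneg_left hdb (pe1.le.trans hea)
  have s5 : b1 * a2 ≤ b1 * e2 := mul_le_mul_of_nonneg_left hae pb1.le
  have s6 : e2 * b1 ≤ e2 * d1 := mul_le_mul_of_nonneg_left hbd (pa2.le.trans hae)
  have x1 : a1 ≤ e1 := le_of_mul_le_mul_right (by linarith : a1 * d2 ≤ e1 * d2) pd2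
  have x2 : e2 ≤ a2 := le_of_mul_le_mul_left (by linarith : b1 * e2 ≤ b1 * a2) pb1
  exact hne ⟨by linarith, by linarith⟩

namespace IsObstacle

variable {K : Set Plane} {l r t m : Plane} {p : Plane} {c c' : Bool × Bool}

theorem isChordCorner (hK : IsObstacle K l r t m) (σ τ : Bool) :
    IsChordCorner K σ τ (cond σ l r) (cond τ t m) (cond σ r l) := by
  obtain ⟨-, h2, h3, h4, h5, -⟩ := hK.ne
  constructor
  · cases σ <;> simp [hK.l_mem, hK.r_mem]
  · cases τ <;> simp [hK.t_mem, hK.m_mem]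
  · cases σ <;> simp [hK.l_mem, hK.r_mem]
  · cases σ <;> simpa [signedX] using by first | exact hK.l_le | exact hK.le_r
  · cases τ <;> simpa [signedY] using by first | exact hK.le_t | exact hK.m_le
  · cases σ <;> simpa [signedX] using by first | exact hK.l_le | exact hK.le_r
  · cases σ <;> cases τ <;> simp [h2, h3, h4, h5]
  · cases σ <;> cases τ <;> simp [h2, h3, h4, h5]

theorem eq_of_mem_outerSide (hK : IsObstacle K l r t m) (hp : p ∈ interior K)
    (h : p ∈ outerSide l r t m c) (h' : p ∈ outerSide l r t m c') : c = c' := by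
  obtain ⟨σ, τ⟩ := c
  obtain ⟨σ', τ'⟩ := c'
  have hc := hK.isChordCorner σ τ
  have hc' := hK.isChordCorner σ' τ'
  obtain ⟨h1, h2⟩ := hc.lt_top_and_left_lt (lt_signedX_of_mem_interior hp hc.left_le)
    (signedY_lt_of_mem_interior hp hc.le_top) h
  obtain ⟨h3, h4⟩ := hc'.lt_top_and_left_lt (lt_signedX_of_mem_interior hp hc'.left_le)
    (signedY_lt_of_mem_interior hp hc'.le_top) h'
  by_cases hσ : σ' = σ
  · subst hσ
    by_cases hτ : τ' = τ
    · rw [hτ]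
    · obtain rfl : τ' = !τ := Bool.eq_not.2 hτ
      cases τ <;> simp [signedY] at h2 h4 <;> linarith
  · obtain rfl : σ' = !σ := Bool.eq_not.2 hσ
    by_cases hτ : τ' = τ
    · subst hτ
      cases σ <;> simp [signedX] at h1 h3 <;> linarith
    · obtain rfl : τ' = !τ := Bool.eq_not.2 hτ
      obtain ⟨-, n2, n3, n4, n5, -⟩ := hK.ne
      have hneg := hc.chordSide_neg_of_opposite (e := cond (!τ) t m) (p := p)
        (by cases σ <;> exact hc') (by cases σ <;> cases τ <;> simp [n2, n3, n4, n5]) hp h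
      cases σ <;> exact absurd h' (not_le.2 hneg)

theorem exists_mem_outerSide_of_notMem_core (hK : IsObstacle K l r t m) (hp : p ∈ K)
    (hpC : p ∉ convexHull ℝ {l, r, t, m}) : ∃ c, p ∈ outerSide l r t m c := by
  have hclosed : IsClosed (convexHull ℝ ({l, r, t, m} : Set Plane)) :=
    (Set.toFinite _).isClosed_convexHull ℝ
  obtain ⟨f, u, hfu, hup⟩ := geometric_hahn_banach_closed_point (convex_convexHull ℝ _) hclosed hpC
  have hf : ∀ q ∈ ({l, r, t, m} : Set Plane), f q < f p := fun q hq =>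
    (hfu q (subset_convexHull ℝ _ hq)).trans hup
  obtain ⟨σ, τ, α, β, hα, hβ, hαβ⟩ : ∃ (σ τ : Bool) (α β : ℝ), α ≤ 0 ∧ 0 ≤ β ∧
      ∀ q, f q = α * signedX σ q + β * signedY τ q := by
    obtain ⟨α, β, hαβ⟩ := exists_strongDual_eq true true f
    rcases le_total α 0 with hα | hα <;> rcases le_total 0 β with hβ | hβ
    · exact ⟨true, true, α, β, hα, hβ, hαβ⟩
    · exact ⟨true, false, α, -β, hα, by linarith, fun q => by simp [hαβ, signedX, signedY]⟩
    · exact ⟨false, true, -α, β, by linarith, hβ, fun q => by simp [hαβ, signedX, signedY]⟩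
    · exact ⟨false, false, -α, -β, by linarith, by linarith,
        fun q => by simp [hαβ, signedX, signedY]⟩
  simp only [hαβ] at hf
  exact ⟨(σ, τ), (hK.isChordCorner σ τ).chordSide_nonneg_of_separated hp hα hβ
    (hf _ (by cases σ <;> simp)) (hf _ (by cases τ <;> simp))⟩

theorem exists_mem_outerSide (hK : IsObstacle K l r t m) (hp : p ∈ interior K)
    (hpC : p ∉ interior (convexHull ℝ {l, r, t, m})) : ∃ c, p ∈ outerSide l r t m c := by
  by_contra! h
  refine hpC (mem_interior.2 ⟨interior K ∩ ⋂ c, (outerSide l r t m c)ᶜ, fun q hq => ?_,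
    isOpen_interior.inter
      (isOpen_iInter_of_finite fun c => (isClosed_outerSide l r t m c).isOpen_compl),
    hp, mem_iInter.2 h⟩)
  by_contra hqC
  obtain ⟨c, hc⟩ := hK.exists_mem_outerSide_of_notMem_core (interior_subset hq.1) hqC
  exact mem_iInter.1 hq.2 c hc

theorem core_subset (hK : IsObstacle K l r t m) : convexHull ℝ {l, r, t, m} ⊆ K :=
  convexHull_min (by
    simp [insert_subset_iff, hK.l_mem, hK.r_mem, hK.t_mem, hK.m_mem]) hK.convex

/-- A path avoiding the interior of the core can be pushed out of one pocket of the obstacle. -/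
theorem exists_path_avoiding_pocket (hK : IsObstacle K l r t m) (c : Bool × Bool) {γ : ℝ → Plane}
    (hγ : ContinuousOn γ (Icc 0 1))
    (hcore : ∀ x ∈ Icc (0 : ℝ) 1, γ x ∉ interior (convexHull ℝ {l, r, t, m})) :
    ∃ γ' : ℝ → Plane, ContinuousOn γ' (Icc 0 1) ∧
      eVariationOn γ' (Icc 0 1) ≤ eVariationOn γ (Icc 0 1) ∧
      (∀ x, γ' x ∉ interior K ∩ outerSide l r t m c) ∧
      (∀ x, γ x ∉ interior K → γ' x = γ x) ∧
      ∀ x, γ' x = γ x ∨ ((interior K).Nonempty ∧ γ' x ∈ K \ interior K) := by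
  by_cases hint : (interior K).Nonempty
  swap
  · rw [not_nonempty_iff_eq_empty] at hint
    exact ⟨γ, hγ, le_rfl, by simp [hint], fun _ _ => rfl, fun _ => Or.inl rfl⟩
  obtain ⟨e, he, heK, hfix⟩ :=
    (hK.isChordCorner c.1 c.2).exists_retraction hK.isCompact hK.convex hint
  set S := interior K ∩ outerSide l r t m c with hS
  have hST : S ⊆ K ∩ outerSide l r t m c := inter_subset_inter_left _ interior_subset
  set O := interior K ∩ ⋂ c', ⋂ (_ : c' ≠ c), (outerSide l r t m c')ᶜ with hOdef
  have hO : IsOpen O := isOpen_interior.inter (isOpen_iInter_of_finite fun c' =>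
    isOpen_iInter_of_finite fun _ => (isClosed_outerSide l r t m c').isOpen_compl)
  have hSO : ∀ x ∈ Icc (0 : ℝ) 1, γ x ∈ S ↔ γ x ∈ O := by
    intro x hx
    constructor
    · rintro ⟨h1, h2⟩
      refine ⟨h1, mem_iInter₂.2 fun c' hc' h3 => hc' (hK.eq_of_mem_outerSide h1 h3 h2)⟩
    · rintro ⟨h1, h2⟩
      refine ⟨h1, ?_⟩
      obtain ⟨c', hc'⟩ := hK.exists_mem_outerSide h1 (hcore x hx)
      by_cases h : c' = c
      · exact h ▸ hc'
      · exact absurd hc' (mem_iInter₂.1 h2 c' h)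
  classical
  obtain ⟨hcont, hvar⟩ := continuousOn_and_eVariationOn_le_of_lipschitzOnWith hγ
    (hK.isCompact.isClosed.inter (isClosed_outerSide l r t m c)) hO hSO hST he
    fun p hp => hfix p hp.1 fun h => hp.2 ⟨h, hp.1.2⟩
  refine ⟨_, hcont, hvar, fun x => ?_, fun x hx => ?_, fun x => ?_⟩
  · by_cases hx : γ x ∈ S
    · rw [if_pos hx]
      exact fun h => (heK _ (hST hx)).2 h.1
    · rwa [if_neg hx]
  · exact if_neg fun h => hx h.1
  · by_cases hx : γ x ∈ S
    · rw [if_pos hx]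
      exact Or.inr ⟨hint, heK _ (hST hx)⟩
    · exact Or.inl (if_neg hx)

end IsObstacle

theorem notMem_interior_of_disjoint {E : Type*} [AddCommGroup E] [Module ℝ E] [TopologicalSpace E]
    [IsTopologicalAddGroup E] [ContinuousSMul ℝ E] {K L : Set E} (hK : Convex ℝ K)
    (hint : (interior K).Nonempty) (hKL : Disjoint (interior K) (interior L)) {p : E}
    (hp : p ∈ K) : p ∉ interior L := by
  have hcl : p ∈ closure (interior K) := by
    rw [hK.closure_interior_eq_closure_of_nonempty_interior hint]
    exact subset_closure hp
  exact fun h => (hKL.closure_left isOpen_interior).notMem_of_mem_left hcl h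

/-- A path avoiding the interiors of all cores can be pushed out of finitely many pockets. -/
theorem exists_path_avoiding_pockets {ι : Type*} {K : ι → Set Plane} {l r t m : ι → Plane}
    (hK : ∀ i, IsObstacle (K i) (l i) (r i) (t i) (m i))
    (hKdisj : Pairwise fun i j => Disjoint (interior (K i)) (interior (K j)))
    {γ : ℝ → Plane} (hγ : ContinuousOn γ (Icc 0 1))
    (hcore : ∀ x ∈ Icc (0 : ℝ) 1, ∀ i, γ x ∉ interior (convexHull ℝ {l i, r i, t i, m i}))
    (F : Finset (ι × Bool × Bool)) :
    ∃ γ' : ℝ → Plane, ContinuousOn γ' (Icc 0 1) ∧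
      eVariationOn γ' (Icc 0 1) ≤ eVariationOn γ (Icc 0 1) ∧
      (∀ x ∈ Icc (0 : ℝ) 1, ∀ i, γ' x ∉ interior (convexHull ℝ {l i, r i, t i, m i})) ∧
      (∀ x, (∀ i, γ x ∉ interior (K i)) → γ' x = γ x) ∧
      ∀ c ∈ F, ∀ x, γ' x ∉ interior (K c.1) ∩ outerSide (l c.1) (r c.1) (t c.1) (m c.1) c.2 := by
  classical
  induction F using Finset.induction_on with
  | empty => exact ⟨γ, hγ, le_rfl, hcore, fun _ _ => rfl, by simp⟩
  | insert c F _ ih =>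
    obtain ⟨γ₁, hcont₁, hvar₁, hcore₁, hfix₁, hF₁⟩ := ih
    obtain ⟨γ₂, hcont₂, hvar₂, hc₂, hfix₂, hor⟩ :=
      (hK c.1).exists_path_avoiding_pocket c.2 hcont₁ fun x hx => hcore₁ x hx c.1
    have hor' : ∀ x, γ₂ x = γ₁ x ∨ ∀ i, γ₂ x ∉ interior (K i) := by
      intro x
      refine (hor x).imp_right ?_
      rintro ⟨hint, hxK, hxint⟩ i
      by_cases hi : c.1 = i
      · exact hi ▸ hxint
      · exact notMem_interior_of_disjoint (hK c.1).convex hint (hKdisj hi) hxK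
    refine ⟨γ₂, hcont₂, hvar₂.trans hvar₁, fun x hx i => ?_, fun x hx => ?_, fun c' hc' x => ?_⟩
    · rcases hor' x with h | h
      · exact h ▸ hcore₁ x hx i
      · exact fun h' => h i (interior_mono (hK i).core_subset h')
    · have h := hfix₁ x hx
      rw [← h]
      exact hfix₂ x (h ▸ hx c.1)
    · rcases Finset.mem_insert.1 hc' with rfl | hc'
      · exact hc₂ x
      · rcases hor' x with h | h
        · exact h ▸ hF₁ c' hc' x
        · exact fun h' => h _ h'.1

/-- Lemma 4 of the paper, path version: given pairwise interior-disjoint compact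
convex obstacles with their cores, any continuous `s`–`t` path avoiding the
interiors of all cores can be replaced by a continuous `s`–`t` path avoiding the
interiors of all obstacles whose `L1` length is no larger. -/
theorem path_avoiding_cores_replaceable (h : ℕ) (K : Fin h → Set Plane)
    (hKc : ∀ i, IsCompact (K i)) (hKconv : ∀ i, Convex ℝ (K i))
    (hKdisj : Pairwise fun i j => Disjoint (interior (K i)) (interior (K j)))
    (l r t m : Fin h → Plane)
    (hl : ∀ i, l i ∈ K i) (hr : ∀ i, r i ∈ K i)
    (ht : ∀ i, t i ∈ K i) (hm : ∀ i, m i ∈ K i)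
    (hlmin : ∀ i, ∀ q ∈ K i, px (l i) ≤ px q)
    (hrmax : ∀ i, ∀ q ∈ K i, px q ≤ px (r i))
    (htmax : ∀ i, ∀ q ∈ K i, py q ≤ py (t i))
    (hmmin : ∀ i, ∀ q ∈ K i, py (m i) ≤ py q)
    (hne : ∀ i, l i ≠ r i ∧ l i ≠ t i ∧ l i ≠ m i ∧
                r i ≠ t i ∧ r i ≠ m i ∧ t i ≠ m i)
    (s tgt : Plane) (hs : ∀ i, s ∉ interior (K i)) (htgt : ∀ i, tgt ∉ interior (K i))
    (γ : ℝ → Plane) (hγc : ContinuousOn γ (Set.Icc 0 1))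
    (hγ0 : γ 0 = s) (hγ1 : γ 1 = tgt)
    (hγim : Disjoint (γ '' Set.Icc 0 1)
      (⋃ i, interior (convexHull ℝ {l i, r i, t i, m i}))) :
    ∃ γ' : ℝ → Plane, ContinuousOn γ' (Set.Icc 0 1) ∧ γ' 0 = s ∧ γ' 1 = tgt ∧
      Disjoint (γ' '' Set.Icc 0 1) (⋃ i, interior (K i)) ∧
      eVariationOn γ' (Set.Icc 0 1) ≤ eVariationOn γ (Set.Icc 0 1) := by
  have hK : ∀ i, IsObstacle (K i) (l i) (r i) (t i) (m i) := fun i =>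
    ⟨hKc i, hKconv i, hl i, hr i, ht i, hm i, hlmin i, hrmax i, htmax i, hmmin i, hne i⟩
  have hcore : ∀ x ∈ Icc (0 : ℝ) 1, ∀ i,
      γ x ∉ interior (convexHull ℝ {l i, r i, t i, m i}) := fun x hx i hxi =>
    disjoint_left.1 hγim (mem_image_of_mem γ hx) (mem_iUnion.2 ⟨i, hxi⟩)
  obtain ⟨γ', hcont, hvar, hcore', hfix, havoid⟩ :=
    exists_path_avoiding_pockets hK hKdisj hγc hcore Finset.univ
  refine ⟨γ', hcont, ?_, ?_, ?_, hvar⟩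
  · rw [hfix 0 (by rwa [hγ0]), hγ0]
  · rw [hfix 1 (by rwa [hγ1]), hγ1]
  · rw [disjoint_left]
    rintro _ ⟨x, hx, rfl⟩ hmem
    obtain ⟨i, hi⟩ := mem_iUnion.1 hmem
    obtain ⟨c, hc⟩ := (hK i).exists_mem_outerSide hi (hcore' x hx i)
    exact havoid (i, c) (Finset.mem_univ _) x ⟨hi, hc⟩
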